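/- Let p ∈ (3/4, 1). Then every invariant probability distribution μ on ℕ for the kernel q_p has finite mean: Σ_{j=0}^{∞} j μ(j) < ∞. -/

import Mathlib

open MeasureTheory Filter

noncomputable section

/-- The transition kernel of the Markov chain of leftward-jump counts associated with the
random walk in a homogeneous "have your cookie and eat it" environment with parameter `p`. -/
def qp (p : ℝ) (j k : ℕ) : ℝ :=
  if k = 0 then p ^ (j + 1)
  else (1 - p) * ∑ l ∈ Finset.range (j + 1),
    p ^ l * (Nat.choose (j - l + k - 1) (k - 1) : ℝ) * ((1 : ℝ) / 2) ^ (j - l + k)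

/-- `μ` is an invariant probability distribution on `ℕ` for the kernel `qp p`. -/
def IsInvariantFor (p : ℝ) (μ : ℕ → ℝ) : Prop :=
  (∀ k, 0 ≤ μ k) ∧ (∑' k, μ k) = 1 ∧ ∀ k, (∑' j, μ j * qp p j k) = μ k

lemma qp_nonneg {p : ℝ} (h0 : 0 ≤ p) (h1 : p ≤ 1) (j k : ℕ) : 0 ≤ qp p j k := by
  have : 0 ≤ 1 - p := by linarith
  unfold qp
  split_ifs <;> positivity

lemma qp_succ (p : ℝ) (j k : ℕ) :
    qp p j (k + 1) = ∑ l ∈ Finset.range (j + 1),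
      (1 - p) * p ^ l * ((Nat.choose (k + (j - l)) (j - l) : ℝ) * (1 / 2) ^ (j - l + 1 + k)) := by
  simp only [qp, Nat.add_one_ne_zero, if_false, Finset.mul_sum]
  refine Finset.sum_congr rfl fun l _ => ?_
  have hc : (j - l + (k + 1) - 1).choose (k + 1 - 1) = (k + (j - l)).choose (j - l) := by
    rw [show j - l + (k + 1) - 1 = k + (j - l) by omega, Nat.add_sub_cancel,
      Nat.choose_symm_add]
  rw [hc, show j - l + (k + 1) = j - l + 1 + k by ring]
  ring

lemma hasSum_choose_mul_half_pow (n i : ℕ) :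
    HasSum (fun m : ℕ => (Nat.choose (m + (n + i)) (n + i) : ℝ) * (1 / 2) ^ (n + 1 + m))
      (2 ^ i) := by
  have h := (hasSum_choose_mul_geometric_of_norm_lt_one (𝕜 := ℝ) (n + i) (r := 1 / 2)
    (by norm_num)).mul_left ((1 / 2) ^ (n + 1))
  convert h using 1
  · rfl
  · funext m
    rw [pow_add]
    ring
  · rw [show (1 : ℝ) - 1 / 2 = 2⁻¹ by norm_num, one_div_pow, inv_pow,
      show n + i + 1 = (n + 1) + i by ring, pow_add (2 : ℝ) (n + 1) i]
    field_simp

/-- Second moment of one plus a negative binomial variable with parameters `n + 1` and `1 / 2`. -/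
lemma hasSum_sq_mul_choose_mul_half_pow (n : ℕ) :
    HasSum (fun m : ℕ => ((m : ℝ) + 1) ^ 2 *
      ((Nat.choose (m + n) n : ℝ) * (1 / 2) ^ (n + 1 + m))) ((n : ℝ) ^ 2 + 6 * n + 6) := by
  have h := (((hasSum_choose_mul_half_pow n 2).mul_left (((n : ℝ) + 1) * (n + 2))).sub
    ((hasSum_choose_mul_half_pow n 1).mul_left ((2 * (n : ℝ) + 1) * (n + 1)))).add
    ((hasSum_choose_mul_half_pow n 0).mul_left ((n : ℝ) ^ 2))
  convert h using 1
  · rfl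
  · funext m
    have h1 : ((m : ℝ) + n + 1) * (m + n).choose n = (m + (n + 1)).choose (n + 1) * (n + 1) := by
      exact_mod_cast Nat.add_one_mul_choose_eq (m + n) n
    have h2 : ((m : ℝ) + n + 2) * (m + (n + 1)).choose (n + 1)
        = (m + (n + 2)).choose (n + 2) * (n + 2) := by
      exact_mod_cast Nat.add_one_mul_choose_eq (m + (n + 1)) (n + 1)
    simp only [Nat.add_zero]
    linear_combination (1 / 2 : ℝ) ^ (n + 1 + m) * ((n + 1) * h2
      + ((m : ℝ) + n + 2) * h1 - (2 * (n : ℝ) + 1) * h1)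
  · ring

lemma hasSum_qp {p : ℝ} (j : ℕ) : HasSum (qp p j) 1 := by
  have h : HasSum (fun k => qp p j (k + 1)) (1 - p ^ (j + 1)) := by
    simp only [qp_succ]
    have := hasSum_sum (s := Finset.range (j + 1)) fun l _ =>
      (hasSum_choose_mul_half_pow (j - l) 0).mul_left ((1 - p) * p ^ l)
    convert this using 1
    · rfl
    · rfl
    simp only [pow_zero, mul_one, ← Finset.mul_sum, mul_neg_geom_sum]
  have h' := (hasSum_nat_add_iff 1).1 h
  simpa [qp] using h'

lemma hasSum_sq_mul_qp {p : ℝ} (j : ℕ) : HasSum (fun k : ℕ => (k : ℝ) ^ 2 * qp p j k)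
    (∑ l ∈ Finset.range (j + 1),
      (1 - p) * p ^ l * (((j - l : ℕ) : ℝ) ^ 2 + 6 * (j - l : ℕ) + 6)) := by
  have h : HasSum (fun k : ℕ => ((k + 1 : ℕ) : ℝ) ^ 2 * qp p j (k + 1)) (∑ l ∈ Finset.range (j + 1),
      (1 - p) * p ^ l * (((j - l : ℕ) : ℝ) ^ 2 + 6 * (j - l : ℕ) + 6)) := by
    have := hasSum_sum (s := Finset.range (j + 1)) fun l _ =>
      (hasSum_sq_mul_choose_mul_half_pow (j - l)).mul_left ((1 - p) * p ^ l)
    convert this using 1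
    · rfl
    funext k
    rw [qp_succ, Finset.mul_sum]
    refine Finset.sum_congr rfl fun l _ => ?_
    push_cast
    ring
  have h' := (hasSum_nat_add_iff (f := fun k : ℕ => (k : ℝ) ^ 2 * qp p j k) 1).1 h
  simpa using h'

/-- The squared chain has negative linear drift when `p > 3 / 4`. -/
lemma exists_drift {p : ℝ} (hp : p ∈ Set.Ioo (3 / 4 : ℝ) 1) :
    ∃ c C : ℝ, 0 < c ∧ 0 ≤ C ∧
      ∀ j : ℕ, ∑' k : ℕ, (k : ℝ) ^ 2 * qp p j k ≤ (j : ℝ) ^ 2 - c * j + C := by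
  obtain ⟨hp0, hp1⟩ := hp
  have hq : 0 < 1 - p := by linarith
  obtain ⟨c, hc⟩ : ∃ c, c * (1 - p) = 8 * p - 6 := ⟨(8 * p - 6) / (1 - p), by field_simp⟩
  have hc0 : 0 < c := by
    by_contra! h
    nlinarith
  obtain ⟨C, hC⟩ : ∃ C, C * (1 - p) = 12 * (1 - p) + p * (1 + c) :=
    ⟨(12 * (1 - p) + p * (1 + c)) / (1 - p), by field_simp⟩
  have hC12 : 12 ≤ C := by
    by_contra! h
    nlinarith [mul_pos (show 0 < p by linarith) (show 0 < 1 + c by linarith)]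
  refine ⟨c, C, hc0, by linarith, fun j => ?_⟩
  rw [(hasSum_sq_mul_qp j).tsum_eq]
  induction j with
  | zero => norm_num; linarith
  | succ j ih =>
    rw [Finset.sum_range_succ']
    have : ∑ l ∈ Finset.range (j + 1), (1 - p) * p ^ (l + 1) *
        (((j + 1 - (l + 1) : ℕ) : ℝ) ^ 2 + 6 * (j + 1 - (l + 1) : ℕ) + 6)
        = p * ∑ l ∈ Finset.range (j + 1),
      (1 - p) * p ^ l * (((j - l : ℕ) : ℝ) ^ 2 + 6 * (j - l : ℕ) + 6) := by
      rw [Finset.mul_sum]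
      refine Finset.sum_congr rfl fun l _ => ?_
      rw [Nat.add_sub_add_right]
      ring
    rw [this]
    push_cast
    simp only [pow_zero, mul_one]
    have := mul_le_mul_of_nonneg_left ih (show 0 ≤ p by linarith)
    nlinarith [mul_comm c p]

/-- Integrating a bounded function against an invariant distribution of `qp p`. -/
lemma IsInvariantFor.hasSum_mul_tsum {p : ℝ} (h0 : 0 ≤ p) (h1 : p ≤ 1) {μ : ℕ → ℝ}
    (hμ : IsInvariantFor p μ) {W : ℕ → ℝ} {N : ℝ} (hW0 : ∀ k, 0 ≤ W k) (hWN : ∀ k, W k ≤ N) :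
    HasSum (fun j => μ j * ∑' k, W k * qp p j k) (∑' k, W k * μ k) := by
  obtain ⟨hpos, hsum, hinv⟩ := hμ
  have hs : Summable μ := by
    by_contra h
    simp [tsum_eq_zero_of_not_summable h] at hsum
  have hrow : ∀ j, Summable fun k => W k * qp p j k := fun j =>
    Summable.of_nonneg_of_le (fun k => mul_nonneg (hW0 k) (qp_nonneg h0 h1 j k))
      (fun k => mul_le_mul_of_nonneg_right (hWN k) (qp_nonneg h0 h1 j k))
      ((hasSum_qp j).summable.mul_left N)
  have hrow_nonneg : ∀ j, 0 ≤ ∑' k, W k * qp p j k := fun j =>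
    tsum_nonneg fun k => mul_nonneg (hW0 k) (qp_nonneg h0 h1 j k)
  have hrow_le : ∀ j, ∑' k, W k * qp p j k ≤ N := fun j => by
    have := (hrow j).tsum_le_tsum
      (fun k => mul_le_mul_of_nonneg_right (hWN k) (qp_nonneg h0 h1 j k))
      ((hasSum_qp j).summable.mul_left N)
    simpa [tsum_mul_left, (hasSum_qp j).tsum_eq] using this
  have hsj : Summable fun j => μ j * ∑' k, W k * qp p j k :=
    Summable.of_nonneg_of_le (fun j => mul_nonneg (hpos j) (hrow_nonneg j))
      (fun j => mul_le_mul_of_nonneg_left (hrow_le j) (hpos j)) (hs.mul_right N)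
  have hprod : Summable (Function.uncurry fun j k => μ j * (W k * qp p j k)) := by
    refine (summable_prod_of_nonneg fun x => mul_nonneg (hpos _)
      (mul_nonneg (hW0 _) (qp_nonneg h0 h1 _ _))).2 ⟨fun j => (hrow j).mul_left (μ j), ?_⟩
    simpa [Function.uncurry, tsum_mul_left] using hsj
  have hcomm := hprod.tsum_comm
  rw [hsj.hasSum_iff]
  simp only [tsum_mul_left] at hcomm
  rw [← hcomm]
  refine tsum_congr fun k => ?_
  rw [← hinv k, ← tsum_mul_left]
  exact tsum_congr fun j => by ring

/-- For `p ∈ (3/4, 1)` every invariant distribution of `qp p` has finite mean. -/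
theorem stmt19 (p : ℝ) (hp : p ∈ Set.Ioo (3 / 4 : ℝ) 1)
    (μ : ℕ → ℝ) (hμ : IsInvariantFor p μ) :
    Summable (fun j : ℕ => (j : ℝ) * μ j) := by
  obtain ⟨c, C, hc, hC, hdrift⟩ := exists_drift hp
  have h0 : 0 ≤ p := by linarith [hp.1]
  have h1 : p ≤ 1 := hp.2.le
  have hpos := hμ.1
  have hs : Summable μ := by
    by_contra h
    simpa [tsum_eq_zero_of_not_summable h] using hμ.2.1
  refine summable_of_sum_range_le (c := C / c)
    (fun j => mul_nonneg (Nat.cast_nonneg j) (hpos j)) fun n => ?_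
  set W : ℕ → ℝ := fun k => min ((k : ℝ) ^ 2) ((n : ℝ) ^ 2) with hW
  have hW0 : ∀ k, 0 ≤ W k := fun k => by positivity
  have hWN : ∀ k, W k ≤ (n : ℝ) ^ 2 := fun k => min_le_right _ _
  have hrow : ∀ j, Summable fun k => W k * qp p j k := fun j =>
    Summable.of_nonneg_of_le (fun k => mul_nonneg (hW0 k) (qp_nonneg h0 h1 j k))
      (fun k => mul_le_mul_of_nonneg_right (hWN k) (qp_nonneg h0 h1 j k))
      ((hasSum_qp j).summable.mul_left _)
  have hWμ : Summable fun k => W k * μ k :=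
    Summable.of_nonneg_of_le (fun k => mul_nonneg (hW0 k) (hpos k))
      (fun k => mul_le_mul_of_nonneg_right (hWN k) (hpos k)) (hs.mul_left _)
  have hzero := (hμ.hasSum_mul_tsum h0 h1 hW0 hWN).sub hWμ.hasSum
  rw [sub_self] at hzero
  have hle : ∀ j, μ j * ∑' k, W k * qp p j k - W j * μ j
      ≤ if j ∈ Finset.range n then μ j * (C - c * j) else 0 := fun j => by
    split_ifs with hj
    · have hWj : W j = (j : ℝ) ^ 2 := by
        have : (j : ℝ) ≤ n := by exact_mod_cast (Finset.mem_range.1 hj).le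
        exact min_eq_left (by gcongr)
      have : ∑' k, W k * qp p j k ≤ (j : ℝ) ^ 2 - c * j + C :=
        ((hrow j).tsum_le_tsum
          (fun k => mul_le_mul_of_nonneg_right (min_le_left _ _) (qp_nonneg h0 h1 j k))
          (hasSum_sq_mul_qp j).summable).trans (hdrift j)
      rw [hWj]
      nlinarith [mul_le_mul_of_nonneg_left this (hpos j)]
    · have hWj : W j = (n : ℝ) ^ 2 := by
        have : (n : ℝ) ≤ j := by exact_mod_cast not_lt.1 (mt Finset.mem_range.2 hj)
        exact min_eq_right (by gcongr)
      have : ∑' k, W k * qp p j k ≤ (n : ℝ) ^ 2 := by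
        have := (hrow j).tsum_le_tsum
          (fun k => mul_le_mul_of_nonneg_right (hWN k) (qp_nonneg h0 h1 j k))
          ((hasSum_qp j).summable.mul_left _)
        simpa [tsum_mul_left, (hasSum_qp j).tsum_eq] using this
      rw [hWj]
      nlinarith [mul_le_mul_of_nonneg_left this (hpos j)]
  have hfin : 0 ≤ ∑ j ∈ Finset.range n, μ j * (C - c * j) := by
    have h := hasSum_le hle hzero (hasSum_sum_of_ne_finset_zero (s := Finset.range n)
      fun j hj => if_neg hj)
    rwa [Finset.sum_congr rfl fun j hj => if_pos hj] at h
  have hmass : ∑ j ∈ Finset.range n, μ j ≤ 1 := by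
    rw [← hμ.2.1]
    exact hs.sum_le_tsum _ fun j _ => hpos j
  have hsplit : ∑ j ∈ Finset.range n, μ j * (C - c * j)
      = C * ∑ j ∈ Finset.range n, μ j - c * ∑ j ∈ Finset.range n, (j : ℝ) * μ j := by
    rw [Finset.mul_sum, Finset.mul_sum, ← Finset.sum_sub_distrib]
    exact Finset.sum_congr rfl fun j _ => by ring
  rw [le_div_iff₀ hc]
  nlinarith [mul_le_mul_of_nonneg_left hmass hC]
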